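/- Let R > 0, p > 4, let G̃ = G + ψ with G the standard Gaussian and ψ ∈ W^{2,1}(ℝ²), let J ∈ C⁰(ℝ²) and ε = ‖J − 1‖_{L^∞(B_{2R})}, and let 0 < s ≤ 1. For measurable u: ℝ² → [0,1] vanishing outside B_R, define 𝒫_{J,s}(u)(x) = ∬ u(ξ) G̃_s(x−ξ) J(ξ−η) G̃_s(x−η) u(η) dξ dη. Then there exists a constant C depending on p only such that for all such u₁, u₂: ‖𝒫_{J,s}(u₁) − 𝒫_{J,s}(u₂)‖_{L^∞(ℝ²)} ≤ ((1+ε)C/s) ‖G̃‖²_{W^{1,1}(ℝ²)} R^{2/p} ‖u₁ − u₂‖_{L^p(B_R)} ≤ 2((1+ε)C/s) ‖G̃‖²_{W^{1,1}(ℝ²)} R^{2/p} ‖u₁ − u₂‖_{L¹(B_R)}^{1/p}. In particular the map u ↦ 𝒫_{J,s}(u) is Hölder continuous with exponent 1/p with respect to the L¹(B_R) norm, uniformly on the class of such u. -/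

import Mathlib

open MeasureTheory Metric Set

noncomputable section

abbrev E2 : Type := EuclideanSpace ℝ (Fin 2)

/-- The standard Gaussian on the plane, `G x = (2π)⁻¹ exp (-|x|²/2)`. -/
def Gauss : E2 → ℝ := fun x => (2 * Real.pi)⁻¹ * Real.exp (-‖x‖ ^ 2 / 2)

/-- `g` is the weak partial derivative of `f` in the direction of the `i`-th coordinate. -/
def IsWeakPartialDeriv (i : Fin 2) (f g : E2 → ℝ) : Prop :=
  ∀ φ : E2 → ℝ, ContDiff ℝ (⊤ : ℕ∞) φ → HasCompactSupport φ →
    ∫ x, f x * fderiv ℝ φ x (EuclideanSpace.single i 1) = -∫ x, g x * φ x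

/-- The Hopkins-type bilinear intensity operator
`𝒫(u)(x) = ∬ u ξ Gs (x-ξ) J (ξ-η) Gs (x-η) u η dξ dη`. -/
def Pop (Gs J u : E2 → ℝ) (x : E2) : ℝ :=
  ∫ ξ, ∫ η, u ξ * Gs (x - ξ) * J (ξ - η) * Gs (x - η) * u η

/-- Rescaling `f_s (x) = s⁻² f (x / s)`. -/
def resc (s : ℝ) (f : E2 → ℝ) : E2 → ℝ := fun x => (s⁻¹) ^ 2 * f (s⁻¹ • x)

/-- First classical partial derivatives of the Gaussian. -/
def GaussD (i : Fin 2) (x : E2) : ℝ := fderiv ℝ Gauss x (EuclideanSpace.single i 1)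

/-- Second classical partial derivatives of the Gaussian. -/
def GaussD2 (i j : Fin 2) (x : E2) : ℝ :=
  fderiv ℝ (GaussD i) x (EuclideanSpace.single j 1)


theorem expInt (b : ℝ) (hb : 0 < b) : Integrable (fun x : E2 => Real.exp (-b * ‖x‖ ^ 2)) := by
  apply Integrable.of_integral_ne_zero
  rw [GaussianFourier.integral_rexp_neg_mul_sq_norm hb]
  positivity

theorem Gauss_contDiff : ContDiff ℝ (⊤ : ℕ∞) Gauss := by
  unfold Gauss
  refine contDiff_const.mul (Real.contDiff_exp.comp ?_)
  exact ((contDiff_norm_sq ℝ).neg).div_const 2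

theorem Gauss_int : Integrable Gauss := by
  have := (expInt (1/2) (by norm_num)).const_mul (2 * Real.pi)⁻¹
  refine this.congr (Filter.Eventually.of_forall fun x => ?_)
  simp only [Gauss]
  congr 2
  ring

theorem GaussD_eq (i : Fin 2) (x : E2) : GaussD i x = - (x i) * Gauss x := by
  have h : HasFDerivAt Gauss ((2 * Real.pi)⁻¹ • (Real.exp (-‖x‖ ^ 2 / 2) •
      ((2 : ℝ)⁻¹ • (-((2 : ℕ) • (innerSL ℝ x : E2 →L[ℝ] ℝ)) : E2 →L[ℝ] ℝ)))) x := by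
    unfold Gauss
    refine HasFDerivAt.const_mul (HasFDerivAt.exp ?_) _
    have := ((hasStrictFDerivAt_norm_sq x).hasFDerivAt.neg).mul_const (2 : ℝ)⁻¹
    simpa [div_eq_mul_inv] using this
  rw [GaussD, h.fderiv]
  simp [Gauss, EuclideanSpace.inner_single_right]
  ring

theorem GaussD_int (i : Fin 2) : Integrable (GaussD i) := by
  have h := (expInt (1/4) (by norm_num)).const_mul (2 * Real.pi)⁻¹
  refine h.mono' ?_ (Filter.Eventually.of_forall fun x => ?_)
  · have : Continuous (GaussD i) := by
      have : GaussD i = fun x => - (x i) * Gauss x := funext (GaussD_eq i)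
      rw [this]
      have := Gauss_contDiff.continuous
      fun_prop
    exact this.aestronglyMeasurable
  · rw [GaussD_eq, Gauss, norm_mul, norm_neg, norm_mul, Real.norm_of_nonneg (Real.exp_nonneg _),
      Real.norm_of_nonneg (by positivity : (0:ℝ) ≤ (2 * Real.pi)⁻¹)]
    have h1 : ‖x i‖ ≤ ‖x‖ := PiLp.norm_apply_le x i
    have h2 : ‖x‖ ≤ Real.exp (1 / 4 * ‖x‖ ^ 2) := by
      have := Real.add_one_le_exp (1 / 4 * ‖x‖ ^ 2)
      nlinarith [sq_nonneg (‖x‖ / 2 - 1)]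
    have h3 : Real.exp (-(1/4) * ‖x‖ ^ 2) =
        Real.exp (1 / 4 * ‖x‖ ^ 2) * Real.exp (-‖x‖ ^ 2 / 2) := by
      rw [← Real.exp_add]; congr 1; ring
    rw [h3]
    have : ‖x i‖ ≤ Real.exp (1 / 4 * ‖x‖ ^ 2) := h1.trans h2
    calc _ = (2 * Real.pi)⁻¹ * (‖x i‖ * Real.exp (-‖x‖ ^ 2 / 2)) := by ring
      _ ≤ _ := by gcongr

theorem Gauss_weak (i : Fin 2) : IsWeakPartialDeriv i Gauss (GaussD i) := by
  intro φ hφ hc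
  have hG := Gauss_contDiff
  have hφc := hφ.continuous
  have hD : Continuous (GaussD i) := by
    have : GaussD i = fun x => - (x i) * Gauss x := funext (GaussD_eq i)
    rw [this]
    have := Gauss_contDiff.continuous
    fun_prop
  have hφ' : Continuous (fun x => fderiv ℝ φ x (EuclideanSpace.single i 1)) :=
    (hφ.continuous_fderiv (by simp)).clm_apply continuous_const
  have hc' : HasCompactSupport (fun x => fderiv ℝ φ x (EuclideanSpace.single i 1)) :=
    hc.fderiv_apply ℝ _
  refine integral_mul_fderiv_eq_neg_fderiv_mul_of_integrable ?_ ?_ ?_ ?_ ?_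
  · exact (hD.mul hφc).integrable_of_hasCompactSupport hc.mul_left
  · exact (hG.continuous.mul hφ').integrable_of_hasCompactSupport hc'.mul_left
  · exact (hG.continuous.mul hφc).integrable_of_hasCompactSupport hc.mul_left
  · exact fun x _ => hG.differentiable (by simp) x
  · exact fun x _ => hφ.differentiable (by simp) x

theorem weak_add {i : Fin 2} {f g f' g' : E2 → ℝ} (hf : Integrable f) (hg : Integrable g)
    (hf' : Integrable f') (hg' : Integrable g')
    (h1 : IsWeakPartialDeriv i f f') (h2 : IsWeakPartialDeriv i g g') :
    IsWeakPartialDeriv i (fun x => f x + g x) (fun x => f' x + g' x) := by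
  intro φ hφ hc
  have hφc := hφ.continuous
  have hφ' : Continuous (fun x => fderiv ℝ φ x (EuclideanSpace.single i 1)) :=
    (hφ.continuous_fderiv (by simp)).clm_apply continuous_const
  have hc' : HasCompactSupport (fun x => fderiv ℝ φ x (EuclideanSpace.single i 1)) :=
    hc.fderiv_apply ℝ _
  obtain ⟨M, hM⟩ := hc.exists_bound_of_continuous hφc
  obtain ⟨M', hM'⟩ := hc'.exists_bound_of_continuous hφ'
  have a1 := fun (k : E2 → ℝ) (hk : Integrable k) =>
    hk.mul_bdd hφc.aestronglyMeasurable (Filter.Eventually.of_forall hM)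
  have a2 := fun (k : E2 → ℝ) (hk : Integrable k) =>
    hk.mul_bdd hφ'.aestronglyMeasurable (Filter.Eventually.of_forall hM')
  simp only [add_mul]
  rw [integral_add (a2 f hf) (a2 g hg), integral_add (a1 f' hf') (a1 g' hg'), h1 φ hφ hc,
    h2 φ hφ hc]
  ring

open scoped Convolution in
theorem moll_bound (φ f : E2 → ℝ) (hφ : Continuous φ) (h0 : ∀ x, 0 ≤ φ x)
    (hφi : Integrable φ) (h1 : ∫ x, φ x = 1) (hf : Integrable f) :
    Integrable (f ⋆[ContinuousLinearMap.mul ℝ ℝ, volume] φ) ∧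
    ∫ x, |(f ⋆[ContinuousLinearMap.mul ℝ ℝ, volume] φ) x| ≤ ∫ x, |f x| := by
  have hi := hf.integrable_convolution (ContinuousLinearMap.mul ℝ ℝ) hφi
  refine ⟨hi, ?_⟩
  have hfa : Integrable (fun x => |f x|) := hf.abs
  have hia := hfa.integrable_convolution (ContinuousLinearMap.mul ℝ ℝ) hφi
  have h2 := integral_convolution (ContinuousLinearMap.mul ℝ ℝ) (ν := volume) (μ := volume) hfa hφi
  rw [h1] at h2
  simp only [ContinuousLinearMap.mul_apply', mul_one] at h2
  rw [← h2]
  refine integral_mono hi.abs hia fun x => ?_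
  simp only [convolution_mul]
  refine (abs_integral_le_integral_abs).trans (le_of_eq ?_)
  congr 1
  ext t
  rw [abs_mul, abs_of_nonneg (h0 _)]

open scoped Convolution in
theorem moll_deriv (φ f g : E2 → ℝ) (i : Fin 2) (hφ : ContDiff ℝ (⊤ : ℕ∞) φ)
    (hc : HasCompactSupport φ) (hf : Integrable f) (hw : IsWeakPartialDeriv i f g) (x : E2) :
    fderiv ℝ (f ⋆[ContinuousLinearMap.mul ℝ ℝ, volume] φ) x (EuclideanSpace.single i 1) =
      (g ⋆[ContinuousLinearMap.mul ℝ ℝ, volume] φ) x := by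
  have h1 : ContDiff ℝ 1 φ := hφ.of_le (by simp)
  rw [(hc.hasFDerivAt_convolution_right (ContinuousLinearMap.mul ℝ ℝ)
    hf.locallyIntegrable h1 x).fderiv]
  rw [convolution_precompR_apply _ hf.locallyIntegrable (hc.fderiv ℝ)
    (h1.continuous_fderiv one_ne_zero)]
  simp only [convolution_mul]
  have ht : ContDiff ℝ (⊤ : ℕ∞) (fun t => φ (x - t)) := hφ.comp (contDiff_const.sub contDiff_id)
  have htc : HasCompactSupport (fun t => φ (x - t)) := 
    hc.comp_homeomorph (Homeomorph.subLeft x)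
  have := hw _ ht htc
  have hd : ∀ t, fderiv ℝ (fun t => φ (x - t)) t (EuclideanSpace.single i 1) =
      - fderiv ℝ φ (x - t) (EuclideanSpace.single i 1) := by
    intro t
    have hh : HasFDerivAt (fun t => φ (x - t))
      ((fderiv ℝ φ (x - t)).comp (-(ContinuousLinearMap.id ℝ E2))) t := by
      refine HasFDerivAt.comp t (h1.differentiable one_ne_zero _).hasFDerivAt ?_
      exact (hasFDerivAt_id t).const_sub x
    rw [hh.fderiv]
    simp
  simp only [hd, mul_neg, integral_neg] at this
  linarith

theorem clm_norm_le (L : E2 →L[ℝ] ℝ) : ‖L‖ ≤ ∑ i, |L (EuclideanSpace.single i 1)| := by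
  refine L.opNorm_le_bound (Finset.sum_nonneg fun i _ => abs_nonneg _) fun v => ?_
  have hv : v = ∑ i, v i • (EuclideanSpace.single i (1:ℝ)) := by
    ext j
    simp [Fin.sum_univ_two]
    fin_cases j <;> simp
  have : L v = ∑ i, v i * L (EuclideanSpace.single i 1) := by
    conv_lhs => rw [hv]
    simp
  rw [this, Finset.sum_mul]
  refine (norm_sum_le _ _).trans (Finset.sum_le_sum fun i _ => ?_)
  rw [norm_mul, mul_comm, Real.norm_eq_abs (L _)]
  exact mul_le_mul_of_nonneg_left (PiLp.norm_apply_le v i) (abs_nonneg _)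

theorem cutoff_exists : ∃ (χ : ℕ → E2 → ℝ) (M : ℝ), 0 ≤ M ∧ (∀ n, ContDiff ℝ 1 (χ n)) ∧
    (∀ n, HasCompactSupport (χ n)) ∧ (∀ n x, |χ n x| ≤ 1) ∧ (∀ n x, ‖fderiv ℝ (χ n) x‖ ≤ M) ∧
    (∀ x, Filter.Tendsto (fun n => χ n x) Filter.atTop (nhds 1)) := by
  let b : ContDiffBump (0 : E2) := ⟨1, 2, by norm_num, by norm_num⟩
  have hb : ContDiff ℝ 1 b := b.contDiff
  obtain ⟨M, hM⟩ := (b.hasCompactSupport.fderiv ℝ).exists_bound_of_continuous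
    (hb.continuous_fderiv one_ne_zero)
  refine ⟨fun n x => b (((n : ℝ) + 1)⁻¹ • x), M, (norm_nonneg _).trans (hM 0), ?_, ?_, ?_, ?_, ?_⟩
  · intro n
    exact hb.comp (contDiff_const_smul _)
  · intro n
    exact b.hasCompactSupport.comp_homeomorph
      (Homeomorph.smulOfNeZero (((n : ℝ) + 1)⁻¹) (by positivity))
  · intro n x
    rw [abs_of_nonneg b.nonneg]
    exact b.le_one
  · intro n x
    have hh : HasFDerivAt (fun x : E2 => b (((n : ℝ) + 1)⁻¹ • x))
      ((fderiv ℝ b (((n : ℝ) + 1)⁻¹ • x)).comp (((n : ℝ) + 1)⁻¹ • (ContinuousLinearMap.id ℝ E2))) x := by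
      refine HasFDerivAt.comp (g := (b : E2 → ℝ)) (f := fun x : E2 => ((n : ℝ) + 1)⁻¹ • x) x
        (hb.differentiable one_ne_zero _).hasFDerivAt ?_
      exact (hasFDerivAt_id (𝕜 := ℝ) x).const_smul (((n : ℝ) + 1)⁻¹)
    rw [hh.fderiv]
    have : (fderiv ℝ b (((n : ℝ) + 1)⁻¹ • x)).comp
        (((n : ℝ) + 1)⁻¹ • (ContinuousLinearMap.id ℝ E2)) =
        ((n : ℝ) + 1)⁻¹ • (fderiv ℝ b (((n : ℝ) + 1)⁻¹ • x)) := by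
      ext v; simp
    rw [this, norm_smul]
    have h3 : ‖((n : ℝ) + 1)⁻¹‖ ≤ 1 := by
      rw [Real.norm_of_nonneg (by positivity)]
      exact inv_le_one_of_one_le₀ (by linarith [n.cast_nonneg (α := ℝ)])
    calc _ ≤ 1 * M := by gcongr; exact hM _
      _ = M := one_mul _
  · intro x
    refine tendsto_const_nhds.congr' ?_
    obtain ⟨N, hN⟩ := exists_nat_ge ‖x‖
    filter_upwards [Filter.eventually_ge_atTop N] with n hn
    refine (b.one_of_mem_closedBall ?_).symm
    have hn' : (N : ℝ) ≤ n := by exact_mod_cast hn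
    simp only [mem_closedBall, dist_zero_right, norm_smul, b]
    rw [Real.norm_of_nonneg (by positivity), inv_mul_le_iff₀ (by positivity)]
    linarith

open scoped Convolution in
theorem sob : ∃ K : ℝ, 0 < K ∧ ∀ (f : E2 → ℝ) (g : Fin 2 → E2 → ℝ), Integrable f →
    (∀ i, IsWeakPartialDeriv i f (g i) ∧ Integrable (g i)) →
    eLpNorm f 2 volume ≤ ENNReal.ofReal (K * ((∫ y, |f y|) + ∑ i, ∫ y, |g i y|)) := by
  obtain ⟨χ, M, hM0, hχ, hχc, hχ1, hχM, hχt⟩ := cutoff_exists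
  let c : ℝ := eLpNormLESNormFDerivOneConst (volume : Measure E2) ((2 : NNReal) : ℝ)
  have hc0 : 0 ≤ c := NNReal.coe_nonneg _
  refine ⟨(c + 1) * (M + 1), by positivity, fun f g hf hg => ?_⟩
  let φ : ℕ → ContDiffBump (0 : E2) := fun n =>
    ⟨((n : ℝ) + 1)⁻¹, 2 * ((n : ℝ) + 1)⁻¹, by positivity, by
      have : 0 < ((n : ℝ) + 1)⁻¹ := by positivity
      linarith⟩
  let F : ℕ → E2 → ℝ := fun n => f ⋆[ContinuousLinearMap.mul ℝ ℝ, volume] ((φ n).normed volume)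
  have hφs : ∀ n, ContDiff ℝ (⊤ : ℕ∞) ((φ n).normed volume) := fun n => (φ n).contDiff_normed
  have hφc : ∀ n, HasCompactSupport ((φ n).normed (volume : Measure E2)) :=
    fun n => (φ n).hasCompactSupport_normed
  have hb := fun n (k : E2 → ℝ) (hk : Integrable k) =>
    moll_bound ((φ n).normed volume) k (hφs n).continuous (fun x => (φ n).nonneg_normed x)
      (φ n).integrable_normed ((φ n).integral_normed) hk
  have hF1 : ∀ n, ContDiff ℝ 1 (F n) := fun n =>
    (hφc n).contDiff_convolution_right (n := 1) _ hf.locallyIntegrable ((hφs n).of_le (by simp))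
  have htend : ∀ᵐ x, Filter.Tendsto (fun n => χ n x * F n x) Filter.atTop (nhds (f x)) := by
    have hr : Filter.Tendsto (fun n => (φ n).rOut) Filter.atTop (nhds 0) := by
      have := (tendsto_one_div_add_atTop_nhds_zero_nat (𝕜 := ℝ)).const_mul 2
      simpa [φ] using this
    have := ContDiffBump.ae_convolution_tendsto_right_of_locallyIntegrable (K := 2) 
      (μ := (volume : Measure E2)) hr
      (Filter.Eventually.of_forall fun n => le_refl _) hf.locallyIntegrable
    filter_upwards [this] with x hx
    have h2 := (hχt x).mul hx
    rw [one_mul] at h2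
    refine h2.congr fun n => ?_
    congr 1
    rw [convolution_lsmul_swap]
    simp only [F, convolution_mul, smul_eq_mul]
    simp only [mul_comm]
  have hmeas : ∀ n, ContDiff ℝ 1 (fun x => χ n x * F n x) := fun n => (hχ n).mul (hF1 n)
  refine (Lp.eLpNorm_lim_le_liminf_eLpNorm
    (fun n => (hmeas n).continuous.aestronglyMeasurable) f htend).trans ?_
  refine Filter.liminf_le_of_le ?_ ?_
  · exact Filter.isBoundedUnder_of ⟨0, fun _ => zero_le⟩
  intro B hB
  obtain ⟨n, hn⟩ := hB.exists
  refine hn.trans ?_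
  have hsob := eLpNorm_le_eLpNorm_fderiv_one (volume : Measure E2) (hmeas n)
    ((hχc n).mul_right) (p := 2) (by
      simp only [finrank_euclideanSpace, Fintype.card_fin]
      exact ⟨by rw [Nat.cast_ofNat]; ext; norm_num, by norm_num, by norm_num⟩)
  refine hsob.trans ?_
  have hintegr : Integrable (fun x => (∑ i,
      |(g i ⋆[ContinuousLinearMap.mul ℝ ℝ, volume] ((φ n).normed volume)) x|) + M * |F n x|) :=
    (integrable_finsetSum _ fun i _ => (hb n (g i) (hg i).2).1.abs).add
      ((hb n f hf).1.abs.const_mul M)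
  have hD : eLpNorm (fderiv ℝ (fun x => χ n x * F n x)) 1 volume ≤
      ENNReal.ofReal ((M + 1) * ((∫ y, |f y|) + ∑ i, ∫ y, |g i y|)) := by
    rw [eLpNorm_one_eq_lintegral_enorm]
    have hle : ∫ x, ((∑ i,
      |(g i ⋆[ContinuousLinearMap.mul ℝ ℝ, volume] ((φ n).normed volume)) x|) + M * |F n x|) ≤
        (M + 1) * ((∫ y, |f y|) + ∑ i, ∫ y, |g i y|) := by
      rw [integral_add (integrable_finsetSum _ fun i _ => (hb n (g i) (hg i).2).1.abs)
        ((hb n f hf).1.abs.const_mul M),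
        integral_finsetSum _ fun i _ => (hb n (g i) (hg i).2).1.abs, integral_const_mul]
      have e1 : ∑ i, ∫ x, |(g i ⋆[ContinuousLinearMap.mul ℝ ℝ, volume] ((φ n).normed volume)) x| ≤
          ∑ i, ∫ y, |g i y| := Finset.sum_le_sum fun i _ => (hb n (g i) (hg i).2).2
      have e2 : ∫ x, |F n x| ≤ ∫ y, |f y| := (hb n f hf).2
      have e3 : 0 ≤ ∑ i, ∫ y, |g i y| :=
        Finset.sum_nonneg fun i _ => integral_nonneg fun y => abs_nonneg _
      have e4 : 0 ≤ ∫ y, |f y| := integral_nonneg fun y => abs_nonneg _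
      nlinarith [mul_le_mul_of_nonneg_left e2 hM0, mul_nonneg hM0 e3]
    refine le_trans ?_ (ENNReal.ofReal_le_ofReal hle)
    rw [ofReal_integral_eq_lintegral_ofReal hintegr (Filter.Eventually.of_forall fun x => by
      simp only [Pi.zero_apply]
      have : 0 ≤ M * |F n x| := by positivity
      have := Finset.sum_nonneg fun i (_ : i ∈ Finset.univ) =>
        abs_nonneg ((g i ⋆[ContinuousLinearMap.mul ℝ ℝ, volume] ((φ n).normed volume)) x)
      linarith)]
    refine lintegral_mono fun x => ?_
    rw [← ofReal_norm]
    refine ENNReal.ofReal_le_ofReal ?_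
    have hd := ((hχ n).differentiable one_ne_zero x).hasFDerivAt.mul
      ((hF1 n).differentiable one_ne_zero x).hasFDerivAt
    have hfd : ‖fderiv ℝ (F n) x‖ ≤
        ∑ i, |(g i ⋆[ContinuousLinearMap.mul ℝ ℝ, volume] ((φ n).normed volume)) x| := by
      refine (clm_norm_le _).trans (le_of_eq ?_)
      refine Finset.sum_congr rfl fun i _ => ?_
      rw [← moll_deriv _ f (g i) i (hφs n) (hφc n) hf (hg i).1 x]
    change ‖fderiv ℝ (χ n * F n) x‖ ≤ _
    rw [hd.fderiv]
    refine (norm_add_le _ _).trans ?_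
    rw [norm_smul, norm_smul, Real.norm_eq_abs, Real.norm_eq_abs]
    refine add_le_add ?_ ?_
    · calc _ ≤ 1 * ‖fderiv ℝ (F n) x‖ := by gcongr; exact hχ1 n x
        _ ≤ _ := by rw [one_mul]; exact hfd
    · rw [mul_comm]
      gcongr
      exact hχM n x
  have hN : 0 ≤ (M + 1) * ((∫ y, |f y|) + ∑ i, ∫ y, |g i y|) := by
    have e3 : 0 ≤ ∑ i, ∫ y, |g i y| :=
        Finset.sum_nonneg fun i _ => integral_nonneg fun y => abs_nonneg _
    have e4 : 0 ≤ ∫ y, |f y| := integral_nonneg fun y => abs_nonneg _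
    positivity
  calc _ ≤ ENNReal.ofReal c * ENNReal.ofReal ((M + 1) * ((∫ y, |f y|) + ∑ i, ∫ y, |g i y|)) := by
        gcongr
        simp [c]
    _ = ENNReal.ofReal (c * ((M + 1) * ((∫ y, |f y|) + ∑ i, ∫ y, |g i y|))) :=
        (ENNReal.ofReal_mul hc0).symm
    _ ≤ _ := ENNReal.ofReal_le_ofReal (by nlinarith)

theorem rpow_le_aux (t q : ℝ) (ht : 0 ≤ t) (hq : 1 ≤ q) (hq2 : q ≤ 2) : t ^ q ≤ t + t ^ 2 := by
  rcases le_total t 1 with h | h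
  · have := Real.rpow_le_rpow_of_exponent_ge' ht h zero_le_one hq
    rw [Real.rpow_one] at this
    nlinarith [sq_nonneg t]
  · have := Real.rpow_le_rpow_of_exponent_le h hq2
    rw [Real.rpow_two] at this
    linarith

theorem Lq_bound (q K N : ℝ) (hq : 1 ≤ q) (hq2 : q ≤ 2) (hK : 0 < K) (hN : 0 ≤ N)
    (f : E2 → ℝ) (hf : Integrable f) (hfN : ∫ x, |f x| ≤ N)
    (h2 : eLpNorm f 2 volume ≤ ENNReal.ofReal (K * N)) :
    MemLp f (ENNReal.ofReal q) volume ∧ (∫ x, |f x| ^ q) ^ (1 / q) ≤ (1 + K ^ 2) ^ (1 / q) * N := by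
  have hq0 : 0 < q := by linarith
  have hm2 : MemLp f 2 volume := ⟨hf.1, h2.trans_lt ENNReal.ofReal_lt_top⟩
  have hi2 : Integrable (fun x => |f x| ^ 2) := by
    simpa using hm2.integrable_norm_pow (p := 2) (by norm_num)
  have hm : AEStronglyMeasurable (fun x => |f x| ^ q) volume :=
    (hf.1.aemeasurable.norm.pow_const q).aestronglyMeasurable
  have hiq : Integrable (fun x => |f x| ^ q) := by
    refine (hf.abs.add hi2).mono' hm (Filter.Eventually.of_forall fun x => ?_)
    rw [Real.norm_of_nonneg (by positivity)]
    exact rpow_le_aux _ _ (abs_nonneg _) hq hq2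
  have hmq : MemLp f (ENNReal.ofReal q) volume := by
    rw [← integrable_norm_rpow_iff hf.1 (by simpa using hq0) ENNReal.ofReal_ne_top,
      ENNReal.toReal_ofReal hq0.le]
    exact hiq
  refine ⟨hmq, ?_⟩
  have h22 : ∫ x, |f x| ^ 2 ≤ (K * N) ^ 2 := by
    rw [hm2.eLpNorm_eq_integral_rpow_norm (by norm_num) (by norm_num)] at h2
    rw [ENNReal.ofReal_le_ofReal_iff (by positivity)] at h2
    simp only [ENNReal.toReal_ofNat, Real.rpow_two, Real.norm_eq_abs] at h2
    have h0 : 0 ≤ ∫ x, |f x| ^ 2 := integral_nonneg fun x => by positivity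
    calc ∫ x, |f x| ^ 2 = ((∫ x, |f x| ^ 2) ^ (2:ℝ)⁻¹) ^ 2 := by
          rw [← Real.rpow_natCast, ← Real.rpow_mul h0]; norm_num
      _ ≤ _ := by gcongr
  rcases hN.eq_or_lt with rfl | hN
  · have h0 : ∫ x, |f x| = 0 := le_antisymm hfN (integral_nonneg fun x => abs_nonneg _)
    rw [integral_eq_zero_iff_of_nonneg (fun x => abs_nonneg _) hf.abs] at h0
    have : ∫ x, |f x| ^ q = 0 := by
      refine integral_eq_zero_of_ae ?_
      filter_upwards [h0] with x hx
      simp only [Pi.zero_apply] at hx ⊢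
      rw [hx, Real.zero_rpow hq0.ne']
    rw [this, Real.zero_rpow (by positivity)]
    simp
  · have hle : ∫ x, |f x| ^ q ≤ (1 + K ^ 2) * N ^ q := by
      calc ∫ x, |f x| ^ q ≤ ∫ x, (N ^ q * N⁻¹ * |f x| + N ^ q * (N ^ 2)⁻¹ * |f x| ^ 2) := by
            refine integral_mono hiq ((hf.abs.const_mul _).add (hi2.const_mul _)) fun x => ?_
            have := rpow_le_aux (|f x| / N) q (by positivity) hq hq2
            rw [Real.div_rpow (abs_nonneg _) hN.le, div_le_iff₀ (by positivity)] at this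
            refine this.trans (le_of_eq ?_)
            field_simp
        _ = N ^ q * N⁻¹ * (∫ x, |f x|) + N ^ q * (N ^ 2)⁻¹ * ∫ x, |f x| ^ 2 := by
            rw [integral_add (hf.abs.const_mul _) (hi2.const_mul _), integral_const_mul,
              integral_const_mul]
        _ ≤ N ^ q * N⁻¹ * N + N ^ q * (N ^ 2)⁻¹ * (K * N) ^ 2 := by gcongr
        _ = _ := by field_simp
    have h0 : 0 ≤ ∫ x, |f x| ^ q := integral_nonneg fun x => by positivity
    calc _ ≤ ((1 + K ^ 2) * N ^ q) ^ (1 / q) := by gcongr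
      _ = _ := by
        rw [Real.mul_rpow (by positivity) (by positivity), ← Real.rpow_mul hN.le,
          mul_one_div_cancel hq0.ne', Real.rpow_one]

theorem scale_bound (q s : ℝ) (hq : 1 ≤ q) (hs : 0 < s) (f : E2 → ℝ) (hf : Integrable f)
    (hm : MemLp f (ENNReal.ofReal q) volume) (x : E2) :
    Integrable (fun y => resc s f (x - y)) ∧
    MemLp (fun y => resc s f (x - y)) (ENNReal.ofReal q) volume ∧
    (∫ y, |resc s f (x - y)| ^ q) ^ (1 / q) = s ^ (2 / q - 2) * (∫ y, |f y| ^ q) ^ (1 / q) := by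
  have hq0 : 0 < q := by linarith
  have hsi : s⁻¹ ≠ 0 := by positivity
  have hi : Integrable (fun y => resc s f (x - y)) := by
    unfold resc
    exact ((hf.comp_smul hsi).const_mul _).comp_sub_left x
  refine ⟨hi, ?_, ?_⟩
  · rw [← integrable_norm_rpow_iff hf.1 (by simpa using hq0) ENNReal.ofReal_ne_top,
      ENNReal.toReal_ofReal hq0.le] at hm
    rw [← integrable_norm_rpow_iff hi.1 (by simpa using hq0) ENNReal.ofReal_ne_top,
      ENNReal.toReal_ofReal hq0.le]
    have := ((hm.comp_smul hsi).const_mul (‖(s⁻¹) ^ 2‖ ^ q)).comp_sub_left x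
    refine this.congr (Filter.Eventually.of_forall fun y => ?_)
    simp only [resc]
    rw [norm_mul, Real.mul_rpow (norm_nonneg _) (norm_nonneg _)]
  · have h0 : 0 ≤ ∫ y, |f y| ^ q := integral_nonneg fun x => by positivity
    have : ∫ y, |resc s f (x - y)| ^ q = s ^ (2 - 2 * q) * ∫ y, |f y| ^ q := by
      rw [integral_sub_left_eq_self (fun y => |resc s f y| ^ q) volume x]
      simp only [resc, abs_mul]
      have e : ∀ y : E2, (|s⁻¹ ^ 2| * |f (s⁻¹ • y)|) ^ q = |s⁻¹ ^ 2| ^ q * |f (s⁻¹ • y)| ^ q :=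
        fun y => Real.mul_rpow (abs_nonneg _) (abs_nonneg _)
      simp only [e]
      rw [integral_const_mul, Measure.integral_comp_inv_smul_of_nonneg volume
        (fun y => |f y| ^ q) hs.le]
      simp only [finrank_euclideanSpace, Fintype.card_fin, smul_eq_mul]
      rw [← mul_assoc]
      congr 1
      rw [abs_of_pos (by positivity), inv_pow, Real.inv_rpow (by positivity), ← Real.rpow_natCast,
        ← Real.rpow_mul hs.le, ← Real.rpow_neg hs.le, ← Real.rpow_add hs]
      congr 1
      push_cast
      ring
    rw [this, Real.mul_rpow (by positivity) h0, ← Real.rpow_mul hs.le]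
    congr 2
    field_simp

theorem bilin (p q R ε : ℝ) (hpq : p.HolderConjugate q) (hR : 0 < R) (a J u₁ u₂ : E2 → ℝ)
    (ha : Integrable a) (hm : MemLp a (ENNReal.ofReal q) volume) (hJc : Continuous J)
    (hJ : ∀ x ∈ ball (0 : E2) (2 * R), |J x - 1| ≤ ε)
    (hm1 : Measurable u₁) (hm2 : Measurable u₂)
    (h1 : ∀ x, u₁ x ∈ Icc (0 : ℝ) 1) (h2 : ∀ x, u₂ x ∈ Icc (0 : ℝ) 1)
    (hz1 : ∀ x, x ∉ ball (0 : E2) R → u₁ x = 0) (hz2 : ∀ x, x ∉ ball (0 : E2) R → u₂ x = 0) :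
    |(∫ ξ, ∫ η, u₁ ξ * a ξ * J (ξ - η) * a η * u₁ η) -
      (∫ ξ, ∫ η, u₂ ξ * a ξ * J (ξ - η) * a η * u₂ η)| ≤
    2 * (1 + ε) * ((∫ y, |a y| ^ q) ^ (1 / q)) ^ 2 * (Real.pi * R ^ 2) ^ (1 / p) *
      (∫ y, |u₁ y - u₂ y| ^ p) ^ (1 / p) := by
  have hp0 : 0 < p := hpq.pos
  have hε : 0 ≤ ε := (abs_nonneg _).trans (hJ 0 (by simp [hR]))
  let χ : E2 → ℝ := (ball (0 : E2) R).indicator (fun _ => 1)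
  have hχm : Measurable χ := measurable_const.indicator measurableSet_ball
  have hχ0 : ∀ x, 0 ≤ χ x := fun x => indicator_nonneg (fun _ _ => zero_le_one) x
  have hχ1 : ∀ x, χ x ≤ 1 := fun x => indicator_le_self' (fun _ _ => zero_le_one) x
  have hwχ : ∀ x, |u₁ x - u₂ x| ≤ χ x := by
    intro x
    by_cases hx : x ∈ ball (0 : E2) R
    · simp only [χ, indicator_of_mem hx]
      rw [abs_le]
      constructor <;> linarith [(h1 x).1, (h1 x).2, (h2 x).1, (h2 x).2]
    · simp [χ, indicator_of_notMem hx, hz1 x hx, hz2 x hx]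
  have huχ : ∀ u : E2 → ℝ, (∀ x, u x ∈ Icc (0 : ℝ) 1) → (∀ x, x ∉ ball (0 : E2) R → u x = 0) →
      ∀ x, u x ≤ χ x := by
    intro u h hz x
    by_cases hx : x ∈ ball (0 : E2) R
    · simp only [χ, indicator_of_mem hx]
      exact (h x).2
    · simp [χ, indicator_of_notMem hx, hz x hx]
  have hJχ : ∀ ξ η, χ ξ * χ η * |J (ξ - η)| ≤ (1 + ε) * (χ ξ * χ η) := by
    intro ξ η
    by_cases hξ : ξ ∈ ball (0 : E2) R
    · by_cases hη : η ∈ ball (0 : E2) R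
      · have : ξ - η ∈ ball (0 : E2) (2 * R) := by
          rw [mem_ball_zero_iff] at *
          linarith [norm_sub_le ξ η]
        have h3 := hJ _ this
        simp only [χ, indicator_of_mem hξ, indicator_of_mem hη]
        have : |J (ξ - η)| ≤ |J (ξ - η) - 1| + 1 := by
          have := abs_add_le (J (ξ - η) - 1) 1
          simpa using this
        linarith
      · simp [χ, indicator_of_notMem hη]
    · simp [χ, indicator_of_notMem hξ]
  have haa : Integrable (fun z : E2 × E2 => a z.1 * a z.2) (volume.prod volume) := ha.mul_prod ha
  have hintegr : ∀ u : E2 → ℝ, Measurable u → (∀ x, u x ∈ Icc (0 : ℝ) 1) →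
      (∀ x, x ∉ ball (0 : E2) R → u x = 0) →
      Integrable (fun z : E2 × E2 => u z.1 * a z.1 * J (z.1 - z.2) * a z.2 * u z.2)
        (volume.prod volume) := by
    intro u hmu h hz
    have hk : Measurable (fun z : E2 × E2 => u z.1 * u z.2 * J (z.1 - z.2)) := by
      have := hJc.measurable
      fun_prop
    refine (haa.bdd_mul (c := 1 + ε) hk.aestronglyMeasurable
      (Filter.Eventually.of_forall fun z => ?_)).congr (Filter.Eventually.of_forall fun z => ?_)
    · rw [norm_mul, Real.norm_of_nonneg (mul_nonneg (h _).1 (h _).1), Real.norm_eq_abs]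
      calc _ ≤ χ z.1 * χ z.2 * |J (z.1 - z.2)| := by
            gcongr
            · exact (h _).1
            · exact hχ0 _
            · exact huχ u h hz _
            · exact huχ u h hz _
        _ ≤ _ := hJχ _ _
        _ ≤ (1 + ε) * (1 * 1) := by
            gcongr
            · exact hχ0 _
            · exact hχ1 _
            · exact hχ1 _
        _ = _ := by ring
    · simp only
      ring
  have hi1 := hintegr u₁ hm1 h1 hz1
  have hi2 := hintegr u₂ hm2 h2 hz2
  have hmw : Measurable (fun x => |u₁ x - u₂ x|) := (hm1.sub hm2).norm
  have hbw : Integrable (fun y => |u₁ y - u₂ y| * |a y|) :=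
    ha.abs.bdd_mul (c := 1) hmw.aestronglyMeasurable (Filter.Eventually.of_forall fun y => by
      rw [Real.norm_of_nonneg (abs_nonneg _)]
      exact (hwχ y).trans (hχ1 y))
  have hbχ : Integrable (fun y => χ y * |a y|) :=
    ha.abs.bdd_mul (c := 1) hχm.aestronglyMeasurable (Filter.Eventually.of_forall fun y => by
      rw [Real.norm_of_nonneg (hχ0 _)]
      exact (hχ1 y))
  rw [← integral_prod _ hi1, ← integral_prod _ hi2, ← integral_sub hi1 hi2]
  have hA0 : 0 ≤ (∫ y, |a y| ^ q) ^ (1 / q) :=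
    Real.rpow_nonneg (integral_nonneg fun x => by positivity) _
  have hmemb : ∀ v : E2 → ℝ, Measurable v → (∀ x, 0 ≤ v x) → (∀ x, v x ≤ χ x) →
      MemLp v (ENNReal.ofReal p) volume := by
    intro v hv h0 hvχ
    have hχL : MemLp χ (ENNReal.ofReal p) volume :=
      memLp_indicator_const _ measurableSet_ball _ (Or.inr measure_ball_lt_top.ne)
    refine hχL.mono hv.aestronglyMeasurable (Filter.Eventually.of_forall fun x => ?_)
    rw [Real.norm_of_nonneg (h0 x), Real.norm_of_nonneg (hχ0 x)]
    exact hvχ x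
  have holder : ∀ v : E2 → ℝ, Measurable v → (∀ x, 0 ≤ v x) → (∀ x, v x ≤ χ x) →
      ∫ y, v y * |a y| ≤ (∫ y, v y ^ p) ^ (1 / p) * (∫ y, |a y| ^ q) ^ (1 / q) := by
    intro v hv h0 hvχ
    exact integral_mul_le_Lp_mul_Lq_of_nonneg hpq (Filter.Eventually.of_forall h0)
      (Filter.Eventually.of_forall fun y => abs_nonneg _) (hmemb v hv h0 hvχ) hm.norm
  have hw := holder _ hmw (fun x => abs_nonneg _) hwχ
  have hc := holder χ hχm hχ0 (fun x => le_rfl)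
  have hχp : ∫ y, χ y ^ p = Real.pi * R ^ 2 := by
    have : (fun y => χ y ^ p) = χ := by
      ext y
      by_cases hy : y ∈ ball (0 : E2) R
      · simp [χ, indicator_of_mem hy]
      · simp [χ, indicator_of_notMem hy, Real.zero_rpow hp0.ne']
    rw [this]
    simp only [χ]
    rw [integral_indicator measurableSet_ball]
    simp [Measure.real, EuclideanSpace.volume_ball_fin_two, hR.le, Real.pi_pos.le, mul_comm]
  rw [hχp] at hc
  have hdom : Integrable (fun z : E2 × E2 => (1 + ε) *
      ((|u₁ z.1 - u₂ z.1| * |a z.1|) * (χ z.2 * |a z.2|) +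
       (χ z.1 * |a z.1|) * (|u₁ z.2 - u₂ z.2| * |a z.2|))) (volume.prod volume) :=
    ((hbw.mul_prod hbχ).add (hbχ.mul_prod hbw)).const_mul _
  have hW0 : 0 ≤ ∫ y, |u₁ y - u₂ y| * |a y| := integral_nonneg fun y => by positivity
  have hX0 : 0 ≤ ∫ y, χ y * |a y| := integral_nonneg fun y => mul_nonneg (hχ0 y) (abs_nonneg _)
  calc _ ≤ ∫ z : E2 × E2, (1 + ε) *
      ((|u₁ z.1 - u₂ z.1| * |a z.1|) * (χ z.2 * |a z.2|) +
       (χ z.1 * |a z.1|) * (|u₁ z.2 - u₂ z.2| * |a z.2|)) ∂(volume.prod volume) := by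
        refine abs_integral_le_integral_abs.trans ?_
        refine integral_mono (hi1.sub hi2).abs hdom ?_
        rintro ⟨ξ, η⟩
        simp only
        have e1 : u₁ ξ * a ξ * J (ξ - η) * a η * u₁ η - u₂ ξ * a ξ * J (ξ - η) * a η * u₂ η =
          (u₁ ξ * u₁ η - u₂ ξ * u₂ η) * J (ξ - η) * (a ξ * a η) := by ring
        rw [e1, abs_mul, abs_mul, abs_mul]
        have e2 : |u₁ ξ * u₁ η - u₂ ξ * u₂ η| ≤
            |u₁ ξ - u₂ ξ| * χ η + χ ξ * |u₁ η - u₂ η| := by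
          have : u₁ ξ * u₁ η - u₂ ξ * u₂ η = (u₁ ξ - u₂ ξ) * u₁ η + u₂ ξ * (u₁ η - u₂ η) := by
            ring
          rw [this]
          refine (abs_add_le _ _).trans ?_
          rw [abs_mul, abs_mul, abs_of_nonneg (h1 η).1, abs_of_nonneg (h2 ξ).1]
          gcongr
          · exact huχ u₁ h1 hz1 _
          · exact huχ u₂ h2 hz2 _
        have e3 : ∀ x, |u₁ x - u₂ x| = |u₁ x - u₂ x| * χ x := by
          intro x
          by_cases hx : x ∈ ball (0 : E2) R
          · simp [χ, indicator_of_mem hx]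
          · simp [χ, indicator_of_notMem hx, hz1 x hx, hz2 x hx]
        have e5 : ∀ x, χ x = χ x * χ x := by
          intro x
          by_cases hx : x ∈ ball (0 : E2) R
          · simp [χ, indicator_of_mem hx]
          · simp [χ, indicator_of_notMem hx]
        have e4 : |u₁ ξ * u₁ η - u₂ ξ * u₂ η| * |J (ξ - η)| ≤
            (1 + ε) * (|u₁ ξ - u₂ ξ| * χ η + χ ξ * |u₁ η - u₂ η|) := by
          have hx := mul_le_mul_of_nonneg_left (hJχ ξ η)
            (add_nonneg (abs_nonneg (u₁ ξ - u₂ ξ)) (abs_nonneg (u₁ η - u₂ η)))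
          calc _ ≤ (|u₁ ξ - u₂ ξ| * χ η + χ ξ * |u₁ η - u₂ η|) * |J (ξ - η)| := by gcongr
            _ = |u₁ ξ - u₂ ξ| * (χ ξ * χ η * |J (ξ - η)|) +
                |u₁ η - u₂ η| * (χ ξ * χ η * |J (ξ - η)|) := by
                conv_lhs => rw [e3 ξ, e3 η]
                ring
            _ ≤ |u₁ ξ - u₂ ξ| * ((1 + ε) * (χ ξ * χ η)) +
                |u₁ η - u₂ η| * ((1 + ε) * (χ ξ * χ η)) := by
                rw [← add_mul, ← add_mul]
                exact hx
            _ = (1 + ε) * ((|u₁ ξ - u₂ ξ| * χ ξ) * χ η + χ ξ * (|u₁ η - u₂ η| * χ η)) := by ring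
            _ = _ := by rw [← e3 ξ, ← e3 η]
        calc _ ≤ (1 + ε) * (|u₁ ξ - u₂ ξ| * χ η + χ ξ * |u₁ η - u₂ η|) * (|a ξ| * |a η|) := by
              gcongr
          _ = _ := by ring
    _ = 2 * (1 + ε) * ((∫ y, |u₁ y - u₂ y| * |a y|) * ∫ y, χ y * |a y|) := by
        rw [integral_const_mul, integral_add (hbw.mul_prod hbχ) (hbχ.mul_prod hbw),
          integral_prod_mul (fun y => |u₁ y - u₂ y| * |a y|) (fun y => χ y * |a y|),
          integral_prod_mul (fun y => χ y * |a y|) (fun y => |u₁ y - u₂ y| * |a y|)]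
        ring
    _ ≤ 2 * (1 + ε) * (((∫ y, |u₁ y - u₂ y| ^ p) ^ (1 / p) * (∫ y, |a y| ^ q) ^ (1 / q)) *
          ((Real.pi * R ^ 2) ^ (1 / p) * (∫ y, |a y| ^ q) ^ (1 / q))) := by
        gcongr
    _ = _ := by ring

theorem main0 (p : ℝ) (hp : 4 < p) :
    ∃ C : ℝ, 0 < C ∧
      ∀ (R : ℝ), 0 < R →
      ∀ (f : E2 → ℝ) (f' : Fin 2 → E2 → ℝ),
        Integrable f →
        (∀ i, IsWeakPartialDeriv i f (f' i) ∧ Integrable (f' i)) →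
      ∀ (J : E2 → ℝ), Continuous J →
      ∀ (s : ℝ), 0 < s → s ≤ 1 →
      ∀ (ε : ℝ), (∀ x ∈ ball (0 : E2) (2 * R), |J x - 1| ≤ ε) →
      ∀ (u₁ u₂ : E2 → ℝ), Measurable u₁ → Measurable u₂ →
        (∀ x, u₁ x ∈ Icc (0 : ℝ) 1) → (∀ x, u₂ x ∈ Icc (0 : ℝ) 1) →
        (∀ x, x ∉ ball (0 : E2) R → u₁ x = 0) →
        (∀ x, x ∉ ball (0 : E2) R → u₂ x = 0) →
        (∀ x : E2,
          |Pop (resc s f) J u₁ x - Pop (resc s f) J u₂ x| ≤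
            (1 + ε) * C / s *
              ((∫ y, |f y|) + ∑ i, ∫ y, |f' i y|) ^ 2 *
              R ^ (2 / p) * (∫ y, |u₁ y - u₂ y| ^ p) ^ (1 / p)) := by
  obtain ⟨K, hK, hsob⟩ := sob
  have hp0 : 0 < p := by linarith
  obtain ⟨q, hq⟩ : ∃ q, q = Real.conjExponent p := ⟨_, rfl⟩
  have hpq : p.HolderConjugate q := hq ▸ Real.HolderConjugate.conjExponent (by linarith)
  have hq1 : 1 ≤ q := hpq.symm.lt.le
  have hqi : 1 / q = 1 - 1 / p := by
    have := hpq.inv_add_inv_eq_one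
    simp only [one_div]
    linarith
  have hq0 : 0 < q := by linarith
  have hpi : 1 / p ≤ 1 / 4 := one_div_le_one_div_of_le (by norm_num) hp.le
  have hq2 : q ≤ 2 := by
    have : 1 / 2 ≤ 1 / q := by rw [hqi]; linarith
    exact (one_div_le_one_div (by norm_num) hq0).1 this
  refine ⟨2 * Real.pi ^ (1 / p) * ((1 + K ^ 2) ^ (1 / q)) ^ 2, by positivity, ?_⟩
  intro R hR f f' hf hf' J hJc s hs hs1 ε hJ u₁ u₂ hm1 hm2 h1 h2 hz1 hz2 x
  have hε : 0 ≤ ε := (abs_nonneg _).trans (hJ 0 (by simp [hR]))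
  set N := (∫ y, |f y|) + ∑ i, ∫ y, |f' i y| with hN
  have e3 : 0 ≤ ∑ i, ∫ y, |f' i y| :=
    Finset.sum_nonneg fun i _ => integral_nonneg fun y => abs_nonneg _
  have e4 : 0 ≤ ∫ y, |f y| := integral_nonneg fun y => abs_nonneg _
  have hN0 : 0 ≤ N := by positivity
  obtain ⟨hm, hL⟩ := Lq_bound q K N hq1 hq2 hK hN0 f hf (by linarith) (hsob f f' hf hf')
  obtain ⟨ha, hma, hs'⟩ := scale_bound q s hq1 hs f hf hm x
  have hb := bilin p q R ε hpq hR (fun y => resc s f (x - y)) J u₁ u₂ ha hma hJc hJ hm1 hm2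
    h1 h2 hz1 hz2
  have hI0 : 0 ≤ (∫ y, |u₁ y - u₂ y| ^ p) ^ (1 / p) :=
    Real.rpow_nonneg (integral_nonneg fun x => by positivity) _
  have hA0 : 0 ≤ (∫ y, |f y| ^ q) ^ (1 / q) :=
    Real.rpow_nonneg (integral_nonneg fun x => by positivity) _
  refine hb.trans ?_
  rw [hs']
  have hsp : (s ^ (2 / q - 2)) ^ 2 ≤ 1 / s := by
    rw [← Real.rpow_natCast, ← Real.rpow_mul hs.le, one_div, ← Real.rpow_neg_one]
    refine Real.rpow_le_rpow_of_exponent_ge hs hs1 ?_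
    have : 2 / q = 2 * (1 / q) := by ring
    rw [this, hqi]
    push_cast
    linarith
  have hRp : (Real.pi * R ^ 2) ^ (1 / p) = Real.pi ^ (1 / p) * R ^ (2 / p) := by
    rw [Real.mul_rpow Real.pi_pos.le (by positivity), ← Real.rpow_natCast R,
      ← Real.rpow_mul hR.le]
    congr 2
    push_cast
    ring
  rw [hRp, mul_pow]
  calc _ ≤ 2 * (1 + ε) * (1 / s * ((1 + K ^ 2) ^ (1 / q) * N) ^ 2) *
        (Real.pi ^ (1 / p) * R ^ (2 / p)) * (∫ y, |u₁ y - u₂ y| ^ p) ^ (1 / p) := by gcongr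
    _ = _ := by ring

theorem second_ineq (p R A : ℝ) (hp : 4 < p) (hA : 0 ≤ A) (u₁ u₂ : E2 → ℝ)
    (hm1 : Measurable u₁) (hm2 : Measurable u₂)
    (h1 : ∀ x, u₁ x ∈ Icc (0 : ℝ) 1) (h2 : ∀ x, u₂ x ∈ Icc (0 : ℝ) 1)
    (hz1 : ∀ x, x ∉ ball (0 : E2) R → u₁ x = 0) (hz2 : ∀ x, x ∉ ball (0 : E2) R → u₂ x = 0) :
    A * (∫ y, |u₁ y - u₂ y| ^ p) ^ (1 / p) ≤ 2 * (A * (∫ y, |u₁ y - u₂ y|) ^ (1 / p)) := by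
  have hw1 : ∀ x, |u₁ x - u₂ x| ≤ 1 := fun x => by
    rw [abs_le]
    constructor <;> linarith [(h1 x).1, (h1 x).2, (h2 x).1, (h2 x).2]
  have hmw : Measurable (fun x => |u₁ x - u₂ x|) := (hm1.sub hm2).norm
  have hi : Integrable (fun x => |u₁ x - u₂ x|) := by
    have hχ : Integrable ((ball (0 : E2) R).indicator (fun _ => (1 : ℝ))) :=
      (integrable_indicator_iff measurableSet_ball).2
        (integrableOn_const measure_ball_lt_top.ne)
    refine hχ.mono' hmw.aestronglyMeasurable (Filter.Eventually.of_forall fun x => ?_)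
    rw [Real.norm_of_nonneg (abs_nonneg _)]
    by_cases hx : x ∈ ball (0 : E2) R
    · rw [indicator_of_mem hx]; exact hw1 x
    · simp [indicator_of_notMem hx, hz1 x hx, hz2 x hx]
  have hpw : ∀ x, |u₁ x - u₂ x| ^ p ≤ |u₁ x - u₂ x| := fun x => by
    have := Real.rpow_le_rpow_of_exponent_ge' (abs_nonneg (u₁ x - u₂ x)) (hw1 x) zero_le_one
      (by linarith : (1 : ℝ) ≤ p)
    rwa [Real.rpow_one] at this
  have hle : ∫ y, |u₁ y - u₂ y| ^ p ≤ ∫ y, |u₁ y - u₂ y| :=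
    integral_mono_of_nonneg (Filter.Eventually.of_forall fun x => by positivity) hi
      (Filter.Eventually.of_forall hpw)
  have h0 : 0 ≤ ∫ y, |u₁ y - u₂ y| ^ p := integral_nonneg fun x => by positivity
  have h3 : (∫ y, |u₁ y - u₂ y| ^ p) ^ (1 / p) ≤ (∫ y, |u₁ y - u₂ y|) ^ (1 / p) :=
    Real.rpow_le_rpow h0 hle (by have : 0 < p := by linarith
                                 positivity)
  have h4 : 0 ≤ (∫ y, |u₁ y - u₂ y|) ^ (1 / p) :=
    Real.rpow_nonneg (integral_nonneg fun x => abs_nonneg _) _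
  nlinarith [mul_le_mul_of_nonneg_left h3 hA, mul_nonneg hA h4]

/-- Hölder continuity of `u ↦ 𝒫_{J,s}(u)` with respect to the `L^p` and `L¹` norms,
with constant depending on `p` only: for `u₁, u₂ : ℝ² → [0,1]` vanishing outside `B_R`,
`‖𝒫_{J,s}(u₁) - 𝒫_{J,s}(u₂)‖_{L^∞} ≤ ((1+ε)C/s) ‖G̃‖²_{W^{1,1}} R^{2/p} ‖u₁ - u₂‖_{L^p}`
`≤ 2((1+ε)C/s) ‖G̃‖²_{W^{1,1}} R^{2/p} ‖u₁ - u₂‖_{L¹}^{1/p}`. -/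
theorem stmt17 (p : ℝ) (hp : 4 < p) :
    ∃ C : ℝ, 0 < C ∧
      ∀ (R : ℝ), 0 < R →
      ∀ (ψ : E2 → ℝ) (ψ' : Fin 2 → E2 → ℝ) (ψ'' : Fin 2 → Fin 2 → E2 → ℝ),
        Integrable ψ →
        (∀ i, IsWeakPartialDeriv i ψ (ψ' i) ∧ Integrable (ψ' i)) →
        (∀ i j, IsWeakPartialDeriv j (ψ' i) (ψ'' i j) ∧ Integrable (ψ'' i j)) →
      ∀ (J : E2 → ℝ), Continuous J →
      ∀ (s : ℝ), 0 < s → s ≤ 1 →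
      ∀ (ε : ℝ), (∀ x ∈ ball (0 : E2) (2 * R), |J x - 1| ≤ ε) →
      ∀ (u₁ u₂ : E2 → ℝ), Measurable u₁ → Measurable u₂ →
        (∀ x, u₁ x ∈ Icc (0 : ℝ) 1) → (∀ x, u₂ x ∈ Icc (0 : ℝ) 1) →
        (∀ x, x ∉ ball (0 : E2) R → u₁ x = 0) →
        (∀ x, x ∉ ball (0 : E2) R → u₂ x = 0) →
        (∀ x : E2,
          |Pop (resc s fun z => Gauss z + ψ z) J u₁ x -
              Pop (resc s fun z => Gauss z + ψ z) J u₂ x| ≤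
            (1 + ε) * C / s *
              ((∫ y, |Gauss y + ψ y|) + ∑ i, ∫ y, |GaussD i y + ψ' i y|) ^ 2 *
              R ^ (2 / p) * (∫ y, |u₁ y - u₂ y| ^ p) ^ (1 / p)) ∧
        (1 + ε) * C / s *
            ((∫ y, |Gauss y + ψ y|) + ∑ i, ∫ y, |GaussD i y + ψ' i y|) ^ 2 *
            R ^ (2 / p) * (∫ y, |u₁ y - u₂ y| ^ p) ^ (1 / p) ≤
          2 * ((1 + ε) * C / s) *
            ((∫ y, |Gauss y + ψ y|) + ∑ i, ∫ y, |GaussD i y + ψ' i y|) ^ 2 *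
            R ^ (2 / p) * (∫ y, |u₁ y - u₂ y|) ^ (1 / p) := by
  obtain ⟨C, hC, H⟩ := main0 p hp
  refine ⟨C, hC, ?_⟩
  intro R hR ψ ψ' ψ'' hψ hψ' _ J hJc s hs hs1 ε hJ u₁ u₂ hm1 hm2 h1 h2 hz1 hz2
  have hε : 0 ≤ ε := (abs_nonneg _).trans (hJ 0 (by simp [hR]))
  refine ⟨?_, ?_⟩
  · exact H R hR (fun z => Gauss z + ψ z) (fun i y => GaussD i y + ψ' i y) (Gauss_int.add hψ)
      (fun i => ⟨weak_add Gauss_int hψ (GaussD_int i) (hψ' i).2 (Gauss_weak i) (hψ' i).1,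
        (GaussD_int i).add (hψ' i).2⟩) J hJc s hs hs1 ε hJ u₁ u₂ hm1 hm2 h1 h2 hz1 hz2
  · refine (second_ineq p R ((1 + ε) * C / s *
            ((∫ y, |Gauss y + ψ y|) + ∑ i, ∫ y, |GaussD i y + ψ' i y|) ^ 2 *
            R ^ (2 / p)) hp (by positivity) u₁ u₂ hm1 hm2 h1 h2 hz1 hz2).trans (le_of_eq ?_)
    ring
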